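/- Let p ≥ 2, ε ∈ (0,1), and let u ∈ C¹(B₁) ∩ W^{1,p−1}(B₁), where B₁ is the unit ball of ℝⁿ, be such that ∇u has a distributional Jacobian represented by a locally integrable matrix-valued function D²u with ∫_{B₁} |∇u|^{p−2} |D²u| dx < +∞. Then ∫_{B₁} |∇u|^{p−1} dx ≤ ε ∫_{B₁} |∇u|^{p−2} |D²u| dx + C ε^{1−p} ∫_{B₁} |u|^{p−1} dx, where C depends only on n and p. -/

import Mathlib

open MeasureTheory Metric Set Filter
open scoped RealInnerProductSpace

noncomputable section

abbrev Euc (n : ℕ) := EuclideanSpace ℝ (Fin n)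

theorem abs_abs_rpow_mul_self {q : ℝ} (hq : 1 ≤ q) (s : ℝ) : |(|s| ^ (q - 1) * s)| = |s| ^ q := by
  rw [abs_mul, abs_of_nonneg (by positivity)]
  rcases eq_or_ne s 0 with rfl | hs
  · simp [Real.zero_rpow (by linarith : q ≠ 0)]
  · rw [← Real.rpow_add_one (by positivity)]; simp

theorem hasDerivAt_abs_rpow_mul_self {q : ℝ} (hq : 1 ≤ q) (s : ℝ) :
    HasDerivAt (fun t : ℝ => |t| ^ (q - 1) * t) (q * |s| ^ (q - 1)) s := by
  have pos : ∀ s : ℝ, 0 < s →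
      HasDerivAt (fun t : ℝ => |t| ^ (q - 1) * t) (q * |s| ^ (q - 1)) s := by
    intro s hs
    have h := Real.hasDerivAt_rpow_const (x := s) (p := q) (Or.inl hs.ne')
    rw [abs_of_pos hs]
    refine h.congr_of_eventuallyEq ?_
    filter_upwards [lt_mem_nhds hs] with t ht
    rw [abs_of_pos ht, ← Real.rpow_add_one ht.ne']; simp
  rcases lt_trichotomy s 0 with hs | rfl | hs
  · have h := (pos (-s) (by linarith)).scomp s (hasDerivAt_neg s)
    have h2 : HasDerivAt (fun t : ℝ => -(|-t| ^ (q - 1) * -t))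
        (-(-1 * (q * |-s| ^ (q - 1)))) s := h.neg
    simpa using h2
  · rcases hq.eq_or_lt with rfl | hq
    · simpa using hasDerivAt_id' (0 : ℝ)
    · rw [abs_zero, Real.zero_rpow (by linarith), mul_zero]
      have hc : Tendsto (fun t : ℝ => |t| ^ (q - 1)) (nhds 0) (nhds 0) := by
        have : Continuous (fun t : ℝ => |t| ^ (q - 1)) :=
          continuous_abs.rpow_const fun _ => Or.inr (by linarith)
        simpa [Real.zero_rpow (by linarith : q - 1 ≠ 0)] using this.tendsto 0
      rw [hasDerivAt_iff_tendsto_slope]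
      refine (hc.mono_left nhdsWithin_le_nhds).congr' ?_
      filter_upwards [self_mem_nhdsWithin] with t ht
      have : t ≠ 0 := ht
      simp [slope_def_field]
      field_simp
  · exact pos s hs

theorem add_rpow_le_two_rpow_mul {q a b : ℝ} (hq : 1 ≤ q) (ha : 0 ≤ a) (hb : 0 ≤ b) :
    (a + b) ^ q ≤ 2 ^ q * (a ^ q + b ^ q) := by
  have h := Real.rpow_sum_le_const_mul_sum_rpow (Finset.univ : Finset (Fin 2)) ![a, b] hq
  simp only [Fin.sum_univ_two, Finset.card_univ, Fintype.card_fin] at h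
  simp only [Matrix.cons_val_zero, Matrix.cons_val_one, abs_of_nonneg ha, abs_of_nonneg hb] at h
  refine h.trans ?_
  gcongr
  · norm_num

/-- One-dimensional interpolation: the derivative at the left endpoint is controlled by the
values at both endpoints and a weighted second derivative. -/
theorem abs_deriv_rpow_le {q h : ℝ} (hq : 1 ≤ q) (hh : 0 < h) {f f' f'' : ℝ → ℝ}
    (hf : ∀ t, HasDerivAt f (f' t) t) (hf' : ∀ t, HasDerivAt f' (f'' t) t)
    (hc : Continuous f'') :
    |f' 0| ^ q ≤ (2 / h) ^ q * (|f 0| ^ q + |f h| ^ q)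
      + q * ∫ t in (0 : ℝ)..h, |f' t| ^ (q - 1) * |f'' t| := by
  have hcf' : Continuous f' := continuous_iff_continuousAt.2 fun t => (hf' t).continuousAt
  have hcf : Continuous f := continuous_iff_continuousAt.2 fun t => (hf t).continuousAt
  have hcr : Continuous fun t => |f' t| ^ (q - 1) :=
    hcf'.abs.rpow_const fun _ => Or.inr (by linarith)
  obtain ⟨c, ⟨hc0, hch⟩, hceq⟩ := exists_hasDerivAt_eq_slope f f' hh hcf.continuousOn
    fun t _ => hf t
  have h1 : |f' c| ^ q ≤ (2 / h) ^ q * (|f 0| ^ q + |f h| ^ q) := by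
    have : |f' c| ≤ (1 / h) * (|f 0| + |f h|) := by
      rw [hceq, abs_div, sub_zero, abs_of_pos hh, div_eq_inv_mul, one_div]
      gcongr
      linarith [abs_sub (f h) (f 0)]
    calc |f' c| ^ q ≤ ((1 / h) * (|f 0| + |f h|)) ^ q := by gcongr
      _ = (1 / h) ^ q * (|f 0| + |f h|) ^ q := Real.mul_rpow (by positivity) (by positivity)
      _ ≤ (1 / h) ^ q * (2 ^ q * (|f 0| ^ q + |f h| ^ q)) := by
        gcongr; exact add_rpow_le_two_rpow_mul hq (abs_nonneg _) (abs_nonneg _)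
      _ = _ := by
        rw [← mul_assoc, ← Real.mul_rpow (by positivity) (by positivity)]; congr 2; ring
  have h2 : ∫ t in (0 : ℝ)..c, q * |f' t| ^ (q - 1) * f'' t
      = |f' c| ^ (q - 1) * f' c - |f' 0| ^ (q - 1) * f' 0 := by
    refine intervalIntegral.integral_eq_sub_of_hasDerivAt
      (f := fun t => |f' t| ^ (q - 1) * f' t) (fun t _ => ?_)
      (Continuous.intervalIntegrable (by fun_prop) _ _)
    exact (hasDerivAt_abs_rpow_mul_self hq (f' t)).comp t (hf' t)
  have h3 : |∫ t in (0 : ℝ)..c, q * |f' t| ^ (q - 1) * f'' t|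
      ≤ q * ∫ t in (0 : ℝ)..h, |f' t| ^ (q - 1) * |f'' t| := by
    calc _ ≤ ∫ t in (0 : ℝ)..c, |q * |f' t| ^ (q - 1) * f'' t| :=
          intervalIntegral.abs_integral_le_integral_abs hc0.le
      _ = ∫ t in (0 : ℝ)..c, q * (|f' t| ^ (q - 1) * |f'' t|) := by
        refine intervalIntegral.integral_congr fun t _ => ?_
        rw [abs_mul, abs_mul, abs_of_nonneg (by linarith : 0 ≤ q),
          abs_of_nonneg (by positivity : 0 ≤ |f' t| ^ (q - 1)), mul_assoc]
      _ ≤ ∫ t in (0 : ℝ)..h, q * (|f' t| ^ (q - 1) * |f'' t|) := by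
        refine intervalIntegral.integral_mono_interval le_rfl hc0.le hch.le
          (ae_of_all _ fun t => by simp only [Pi.zero_apply]; positivity)
          (Continuous.intervalIntegrable (by fun_prop) _ _)
      _ = _ := intervalIntegral.integral_const_mul _ _
  have h4 := abs_abs_rpow_mul_self hq (f' 0)
  have h5 := abs_abs_rpow_mul_self hq (f' c)
  rw [h2] at h3
  have h6 := abs_sub_abs_le_abs_sub (|f' 0| ^ (q - 1) * f' 0) (|f' c| ^ (q - 1) * f' c)
  rw [abs_sub_comm] at h6
  linarith

theorem setIntegral_closedBall_comp_homothety_le {n : ℕ} {F : Euc n → ℝ} (hF : Continuous F)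
    (h0 : ∀ x, 0 ≤ F x) {r τ : ℝ} {z : Euc n} (hz : z ∈ closedBall (0 : Euc n) r)
    (hτ0 : 0 ≤ τ) (hτ : τ ≤ 1 / 2) :
    ∫ x in closedBall (0 : Euc n) r, F (x + τ • (z - x))
      ≤ 2 ^ n * ∫ x in closedBall (0 : Euc n) r, F x := by
  set G : Euc n → ℝ := (closedBall (0 : Euc n) r).indicator F with hG
  have hG0 : ∀ x, 0 ≤ G x := fun x => indicator_nonneg (fun y _ => h0 y) x
  have hGi : Integrable G :=
    (hF.continuousOn.integrableOn_compact (isCompact_closedBall _ _)).integrable_indicator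
      measurableSet_closedBall
  have hτ1 : (1 : ℝ) - τ ≠ 0 := by linarith
  have haff : ∀ x : Euc n, x + τ • (z - x) = (1 - τ) • x + τ • z := fun x => by module
  have hint : Integrable fun x : Euc n => G ((1 - τ) • x + τ • z) :=
    (hGi.comp_add_right (τ • z)).comp_smul hτ1
  calc ∫ x in closedBall (0 : Euc n) r, F (x + τ • (z - x))
      = ∫ x in closedBall (0 : Euc n) r, G ((1 - τ) • x + τ • z) := by
        refine setIntegral_congr_fun measurableSet_closedBall fun x hx => ?_
        have : (1 - τ) • x + τ • z ∈ closedBall (0 : Euc n) r :=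
          convex_closedBall _ _ hx hz (by linarith) hτ0 (by ring)
        simp only [haff, hG, indicator_of_mem this]
    _ ≤ ∫ x : Euc n, G ((1 - τ) • x + τ • z) :=
        setIntegral_le_integral hint (ae_of_all _ fun x => hG0 _)
    _ = |((1 - τ) ^ n)⁻¹| * ∫ x : Euc n, G x := by
        rw [Measure.integral_comp_smul volume (fun x => G (x + τ • z)) (1 - τ),
          integral_add_right_eq_self G (τ • z)]
        simp
    _ ≤ 2 ^ n * ∫ x : Euc n, G x := by
        gcongr
        · exact integral_nonneg hG0
        · rw [← inv_pow, abs_pow]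
          gcongr
          rw [abs_of_pos (inv_pos.2 (by linarith))]
          exact inv_le_of_inv_le₀ (by norm_num) (by linarith)
    _ = 2 ^ n * ∫ x in closedBall (0 : Euc n) r, F x := by
        rw [hG, integral_indicator measurableSet_closedBall]

/-- Interpolation for the derivative in the directions pointing to a fixed point `z` of the
ball. -/
theorem setIntegral_fderiv_sub_rpow_le {n : ℕ} {q r h : ℝ} (hq : 1 ≤ q) (hr : r ≤ 1)
    (hh : 0 < h) (hh2 : h ≤ 1 / 2) {w : Euc n → ℝ} (hw : ContDiff ℝ 2 w) {z : Euc n}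
    (hz : z ∈ closedBall (0 : Euc n) r) :
    ∫ x in closedBall (0 : Euc n) r, |fderiv ℝ w x (z - x)| ^ q
      ≤ (2 / h) ^ q * ((1 + 2 ^ n) * ∫ x in closedBall (0 : Euc n) r, |w x| ^ q)
        + q * (2 ^ (q + 1) * (h * (2 ^ n * ∫ x in closedBall (0 : Euc n) r,
            ‖fderiv ℝ w x‖ ^ (q - 1) * ‖fderiv ℝ (fderiv ℝ w) x‖))) := by
  have hw1 : ContDiff ℝ 1 (fderiv ℝ w) := hw.fderiv_right (by norm_num)
  have hcD : Continuous (fderiv ℝ w) := hw1.continuous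
  have hcDD : Continuous (fderiv ℝ (fderiv ℝ w)) := hw1.continuous_fderiv one_ne_zero
  have hcw : Continuous w := hw.continuous
  have hdw : Differentiable ℝ w := hw.differentiable (by norm_num)
  have hdD : Differentiable ℝ (fderiv ℝ w) := hw1.differentiable (by norm_num)
  set F : Euc n → ℝ := fun x => ‖fderiv ℝ w x‖ ^ (q - 1) * ‖fderiv ℝ (fderiv ℝ w) x‖ with hFdef
  have hcN : Continuous fun x => ‖fderiv ℝ (fderiv ℝ w) x‖ :=
    Continuous.norm (E := Euc n →L[ℝ] Euc n →L[ℝ] ℝ) hcDD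
  have hcF : Continuous F :=
    Continuous.mul (hcD.norm.rpow_const fun _ => Or.inr (by linarith)) hcN
  have hF0 : ∀ x, 0 ≤ F x := fun x => by positivity
  have hcq : Continuous fun x => |w x| ^ q := hcw.abs.rpow_const fun _ => Or.inr (by linarith)
  have hK := isCompact_closedBall (0 : Euc n) r
  have hcpath : Continuous fun p : Euc n × ℝ => F (p.1 + p.2 • (z - p.1)) := by fun_prop
  have hprod : Integrable (fun p : Euc n × ℝ => F (p.1 + p.2 • (z - p.1)))
      ((volume.restrict (closedBall (0 : Euc n) r)).prod (volume.restrict (Ioc 0 h))) := by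
    rw [Measure.prod_restrict]
    exact (hcpath.continuousOn.integrableOn_compact (hK.prod isCompact_Icc)).mono_set
      (prod_mono_right Ioc_subset_Icc_self)
  have hpt : ∀ x ∈ closedBall (0 : Euc n) r, |fderiv ℝ w x (z - x)| ^ q
      ≤ (2 / h) ^ q * (|w x| ^ q + |w (x + h • (z - x))| ^ q)
        + q * (2 ^ (q + 1) * ∫ t in Ioc 0 h, F (x + t • (z - x))) := by
    intro x hx
    have hv : ‖z - x‖ ≤ 2 := by
      have h1 := mem_closedBall_zero_iff.1 hx
      have h2 := mem_closedBall_zero_iff.1 hz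
      linarith [norm_sub_le z x]
    have hγ : ∀ t : ℝ, HasDerivAt (fun t : ℝ => x + t • (z - x)) (z - x) t := fun t => by
      simpa using ((hasDerivAt_id' t).smul_const (z - x)).const_add x
    have key := abs_deriv_rpow_le (f := fun t => w (x + t • (z - x)))
      (f' := fun t => fderiv ℝ w (x + t • (z - x)) (z - x))
      (f'' := fun t => fderiv ℝ (fderiv ℝ w) (x + t • (z - x)) (z - x) (z - x)) hq hh
      (fun t => (hdw _).hasFDerivAt.comp_hasDerivAt t (hγ t))
      (fun t => by
        simpa using ((hdD _).hasFDerivAt.comp_hasDerivAt t (hγ t)).clm_apply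
          (hasDerivAt_const t (z - x)))
      (by fun_prop)
    simp only [zero_smul, add_zero] at key
    refine key.trans ?_
    gcongr
    rw [intervalIntegral.integral_of_le hh.le, ← integral_const_mul]
    refine setIntegral_mono_on ?_ ?_ measurableSet_Ioc fun t _ => ?_
    · refine (Continuous.integrableOn_Icc ?_).mono_set Ioc_subset_Icc_self
      refine Continuous.mul (Continuous.rpow_const (by fun_prop) fun _ => Or.inr (by linarith)) ?_
      fun_prop
    · refine (Continuous.integrableOn_Icc ?_).mono_set Ioc_subset_Icc_self
      fun_prop
    · set y := x + t • (z - x)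
      have e1 : |fderiv ℝ w y (z - x)| ≤ ‖fderiv ℝ w y‖ * 2 := by
        rw [← Real.norm_eq_abs]
        exact (ContinuousLinearMap.le_opNorm _ _).trans (by gcongr)
      have e2 : |fderiv ℝ (fderiv ℝ w) y (z - x) (z - x)|
          ≤ ‖fderiv ℝ (fderiv ℝ w) y‖ * 2 * 2 := by
        rw [← Real.norm_eq_abs]
        exact (ContinuousLinearMap.le_opNorm₂ _ _ _).trans (by gcongr)
      calc _ ≤ (‖fderiv ℝ w y‖ * 2) ^ (q - 1) * (‖fderiv ℝ (fderiv ℝ w) y‖ * 2 * 2) := by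
            gcongr
        _ = 2 ^ (q + 1) * F y := by
            rw [Real.mul_rpow (norm_nonneg _) (by norm_num), hFdef,
              show q + 1 = (q - 1) + 2 by ring, Real.rpow_add (by norm_num)]
            norm_num
            ring
  have hswap : ∫ x in closedBall (0 : Euc n) r, ∫ t in Ioc 0 h, F (x + t • (z - x))
      ≤ h * (2 ^ n * ∫ x in closedBall (0 : Euc n) r, F x) := by
    rw [integral_integral_swap hprod]
    calc _ ≤ ∫ _ in Ioc 0 h, (2 ^ n * ∫ x in closedBall (0 : Euc n) r, F x) := by
          refine setIntegral_mono_on hprod.integral_prod_right (integrable_const _)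
            measurableSet_Ioc fun t ht => ?_
          exact setIntegral_closedBall_comp_homothety_le hcF hF0 hz ht.1.le (ht.2.trans hh2)
      _ = _ := by
          rw [setIntegral_const, smul_eq_mul]; simp [hh.le]
  have hshift := setIntegral_closedBall_comp_homothety_le hcq (fun x => by positivity) hz hh.le hh2
  have i1 : IntegrableOn (fun x => |w x| ^ q) (closedBall (0 : Euc n) r) :=
    hcq.continuousOn.integrableOn_compact hK
  have i2 : IntegrableOn (fun x => |w (x + h • (z - x))| ^ q) (closedBall (0 : Euc n) r) :=
    (hcq.comp (f := fun x => x + h • (z - x)) (by fun_prop)).continuousOn.integrableOn_compact hK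
  have i3 : IntegrableOn (fun x => ∫ t in Ioc 0 h, F (x + t • (z - x)))
    (closedBall (0 : Euc n) r) := hprod.integral_prod_left
  have i4 : IntegrableOn (fun x => |fderiv ℝ w x (z - x)| ^ q) (closedBall (0 : Euc n) r) := by
    have : Continuous fun x => |fderiv ℝ w x (z - x)| ^ q :=
      Continuous.rpow_const (by fun_prop) fun _ => Or.inr (by linarith)
    exact this.continuousOn.integrableOn_compact hK
  have i12 : IntegrableOn (fun x => |w x| ^ q + |w (x + h • (z - x))| ^ q)
    (closedBall (0 : Euc n) r) := i1.add i2
  calc _ ≤ ∫ x in closedBall (0 : Euc n) r,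
        ((2 / h) ^ q * (|w x| ^ q + |w (x + h • (z - x))| ^ q)
        + q * (2 ^ (q + 1) * ∫ t in Ioc 0 h, F (x + t • (z - x)))) :=
        setIntegral_mono_on i4 ((i12.const_mul _).add ((i3.const_mul _).const_mul _))
          measurableSet_closedBall hpt
    _ = (2 / h) ^ q * ((∫ x in closedBall (0 : Euc n) r, |w x| ^ q)
          + ∫ x in closedBall (0 : Euc n) r, |w (x + h • (z - x))| ^ q)
        + q * (2 ^ (q + 1) * ∫ x in closedBall (0 : Euc n) r,
          ∫ t in Ioc 0 h, F (x + t • (z - x))) := by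
        rw [integral_add (i12.const_mul _) ((i3.const_mul _).const_mul _),
          integral_const_mul, integral_add i1 i2, integral_const_mul, integral_const_mul]
    _ ≤ _ := by
        gcongr
        linarith

theorem norm_le_sum_norm_apply_single {n : ℕ} {F : Type*} [NormedAddCommGroup F]
    [NormedSpace ℝ F] (L : Euc n →L[ℝ] F) :
    ‖L‖ ≤ ∑ i : Fin n, ‖L (EuclideanSpace.single i 1)‖ := by
  refine L.opNorm_le_bound (by positivity) fun v => ?_
  have hv : v = ∑ i : Fin n, v i • EuclideanSpace.single i (1 : ℝ) := by
    simpa using ((EuclideanSpace.basisFun (Fin n) ℝ).sum_repr v).symm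
  conv_lhs => rw [hv, map_sum]
  refine (norm_sum_le _ _).trans ?_
  rw [Finset.sum_mul]
  refine Finset.sum_le_sum fun i _ => ?_
  rw [map_smul, norm_smul, mul_comm]
  gcongr
  exact PiLp.norm_apply_le v i

/-- The directions from `x` to `0` and to the points `eᵢ / 4` determine a linear form. -/
theorem norm_rpow_le_sum_apply_sub {n : ℕ} {q : ℝ} (hq : 1 ≤ q) (L : Euc n →L[ℝ] ℝ) (x : Euc n) :
    ‖L‖ ^ q ≤ (n : ℝ) ^ (q - 1) * ∑ i : Fin n, 8 ^ q *
      (|L ((1 / 4 : ℝ) • EuclideanSpace.single i (1 : ℝ) - x)| ^ q + |L (0 - x)| ^ q) := by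
  have h1 := Real.rpow_sum_le_const_mul_sum_rpow Finset.univ
    (fun i : Fin n => L (EuclideanSpace.single i 1)) hq
  rw [Finset.card_univ, Fintype.card_fin] at h1
  have h2 : ‖L‖ ^ q ≤ (∑ i : Fin n, |L (EuclideanSpace.single i 1)|) ^ q := by
    gcongr
    simpa using norm_le_sum_norm_apply_single L
  refine h2.trans (h1.trans ?_)
  gcongr with i
  set a := L ((1 / 4 : ℝ) • EuclideanSpace.single i (1 : ℝ) - x) with ha
  set b := L (0 - x) with hb
  have h3 : L (EuclideanSpace.single i 1) = 4 * (a - b) := by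
    rw [ha, hb, map_sub, map_sub, map_smul, map_zero, smul_eq_mul]; ring
  calc |L (EuclideanSpace.single i 1)| ^ q ≤ (4 * (|a| + |b|)) ^ q := by
        rw [h3, abs_mul, abs_of_pos (by norm_num : (0 : ℝ) < 4)]
        gcongr
        exact abs_sub _ _
    _ = 4 ^ q * (|a| + |b|) ^ q := Real.mul_rpow (by norm_num) (by positivity)
    _ ≤ 4 ^ q * (2 ^ q * (|a| ^ q + |b| ^ q)) := by
        gcongr; exact add_rpow_le_two_rpow_mul hq (abs_nonneg _) (abs_nonneg _)
    _ = 8 ^ q * (|a| ^ q + |b| ^ q) := by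
        rw [← mul_assoc, ← Real.mul_rpow (by norm_num) (by norm_num)]; norm_num

/-- The interpolation inequality for functions that are `C²` up to the boundary. -/
theorem exists_setIntegral_norm_fderiv_rpow_le (n : ℕ) {q : ℝ} (hq : 1 ≤ q) :
    ∃ A : ℝ, 1 ≤ A ∧ ∀ r ∈ Icc (1 / 4 : ℝ) 1, ∀ h ∈ Ioc (0 : ℝ) (1 / 2), ∀ w : Euc n → ℝ,
      ContDiff ℝ 2 w →
      ∫ x in closedBall (0 : Euc n) r, ‖fderiv ℝ w x‖ ^ q
        ≤ A * (h * ∫ x in closedBall (0 : Euc n) r,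
            ‖fderiv ℝ w x‖ ^ (q - 1) * ‖fderiv ℝ (fderiv ℝ w) x‖)
          + A * (h ^ (-q) * ∫ x in closedBall (0 : Euc n) r, |w x| ^ q) := by
  set K : ℝ := (n : ℝ) ^ (q - 1) * (n * (8 ^ q * 2)) with hK
  have hK0 : 0 ≤ K := by positivity
  set A₁ : ℝ := K * (2 ^ q * (1 + 2 ^ n))
  set A₂ : ℝ := K * (q * (2 ^ (q + 1) * 2 ^ n))
  refine ⟨max 1 (max A₁ A₂), le_max_left _ _, ?_⟩
  rintro r ⟨hr4, hr1⟩ h ⟨hh0, hh2⟩ w hw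
  set I₀ := ∫ x in closedBall (0 : Euc n) r, |w x| ^ q with hI₀
  set I₂ := ∫ x in closedBall (0 : Euc n) r,
    ‖fderiv ℝ w x‖ ^ (q - 1) * ‖fderiv ℝ (fderiv ℝ w) x‖ with hI₂
  have hI₀0 : 0 ≤ I₀ := integral_nonneg fun x => by positivity
  have hI₂0 : 0 ≤ I₂ := integral_nonneg fun x => by positivity
  set M := (2 / h) ^ q * ((1 + 2 ^ n) * I₀) + q * (2 ^ (q + 1) * (h * (2 ^ n * I₂))) with hM
  have hcD : Continuous (fderiv ℝ w) := hw.continuous_fderiv (by norm_num)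
  have hint : ∀ z : Euc n, IntegrableOn (fun x => |fderiv ℝ w x (z - x)| ^ q)
      (closedBall (0 : Euc n) r) := fun z => by
    have : Continuous fun x => |fderiv ℝ w x (z - x)| ^ q :=
      Continuous.rpow_const (by fun_prop) fun _ => Or.inr (by linarith)
    exact this.continuousOn.integrableOn_compact (isCompact_closedBall _ _)
  have hbound : ∀ z ∈ closedBall (0 : Euc n) r,
      ∫ x in closedBall (0 : Euc n) r, |fderiv ℝ w x (z - x)| ^ q ≤ M :=
    fun z hz => setIntegral_fderiv_sub_rpow_le hq hr1 hh0 hh2 hw hz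
  have hz0 : (0 : Euc n) ∈ closedBall (0 : Euc n) r := mem_closedBall_self (by linarith)
  have hzi : ∀ i : Fin n, (1 / 4 : ℝ) • EuclideanSpace.single i (1 : ℝ)
      ∈ closedBall (0 : Euc n) r := fun i => by
    rw [mem_closedBall_zero_iff, norm_smul]
    simpa using hr4
  have hmain : ∫ x in closedBall (0 : Euc n) r, ‖fderiv ℝ w x‖ ^ q ≤ K * M := by
    have hi : ∀ i : Fin n, IntegrableOn (fun x => 8 ^ q *
        (|fderiv ℝ w x ((1 / 4 : ℝ) • EuclideanSpace.single i (1 : ℝ) - x)| ^ q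
          + |fderiv ℝ w x (0 - x)| ^ q)) (closedBall (0 : Euc n) r) :=
      fun i => ((hint _).add (hint 0)).const_mul _
    calc _ ≤ ∫ x in closedBall (0 : Euc n) r, (n : ℝ) ^ (q - 1) * ∑ i : Fin n, 8 ^ q *
          (|fderiv ℝ w x ((1 / 4 : ℝ) • EuclideanSpace.single i (1 : ℝ) - x)| ^ q
            + |fderiv ℝ w x (0 - x)| ^ q) := by
          refine integral_mono ?_ ((integrable_finsetSum _ fun i _ => hi i).const_mul _)
            fun x => norm_rpow_le_sum_apply_sub hq _ x
          have : Continuous fun x => ‖fderiv ℝ w x‖ ^ q :=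
            hcD.norm.rpow_const fun _ => Or.inr (by linarith)
          exact this.continuousOn.integrableOn_compact (isCompact_closedBall _ _)
      _ = (n : ℝ) ^ (q - 1) * ∑ i : Fin n, 8 ^ q *
          ((∫ x in closedBall (0 : Euc n) r,
            |fderiv ℝ w x ((1 / 4 : ℝ) • EuclideanSpace.single i (1 : ℝ) - x)| ^ q)
          + ∫ x in closedBall (0 : Euc n) r, |fderiv ℝ w x (0 - x)| ^ q) := by
          rw [integral_const_mul, integral_finsetSum _ fun i _ => hi i]
          congr 2 with i
          rw [integral_const_mul, integral_add (hint _) (hint 0)]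
      _ ≤ (n : ℝ) ^ (q - 1) * ∑ i : Fin n, 8 ^ q * (M + M) := by
          gcongr with i
          · exact hbound _ (hzi i)
          · exact hbound _ hz0
      _ = K * M := by
          rw [Finset.sum_const, Finset.card_univ, Fintype.card_fin, nsmul_eq_mul, hK]; ring
  have hM' : K * M = A₂ * (h * I₂) + A₁ * (h ^ (-q) * I₀) := by
    rw [hM, Real.div_rpow (by norm_num) hh0.le, Real.rpow_neg hh0.le]
    ring
  rw [hM'] at hmain
  refine hmain.trans ?_
  gcongr
  · exact (le_max_right _ _).trans (le_max_right _ _)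
  · exact (le_max_left _ _).trans (le_max_right _ _)

theorem gradient_apply_eq_fderiv_single {n : ℕ} (u : Euc n → ℝ) (x : Euc n) (i : Fin n) :
    gradient u x i = fderiv ℝ u x (EuclideanSpace.single i 1) := by
  rw [← inner_gradient_left, EuclideanSpace.inner_single_right]; simp

theorem norm_gradient_eq_norm_fderiv {n : ℕ} (u : Euc n → ℝ) (x : Euc n) :
    ‖gradient u x‖ = ‖fderiv ℝ u x‖ := by
  rw [← toDual_gradient, LinearIsometryEquiv.norm_map]

theorem exists_contDiff_hasCompactSupport_eqOn {n : ℕ} {u : Euc n → ℝ}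
    (hu : ContDiffOn ℝ 1 u (ball 0 1)) {R : ℝ} (hR0 : 0 < R) (hR : R < 1) :
    ∃ W : Euc n → ℝ, ContDiff ℝ 1 W ∧ HasCompactSupport W ∧ EqOn W u (ball 0 R) := by
  let χ : ContDiffBump (0 : Euc n) := ⟨R, (R + 1) / 2, hR0, by linarith⟩
  refine ⟨fun x => χ x * u x, contDiff_iff_contDiffAt.2 fun x => ?_,
    χ.hasCompactSupport.mul_right, fun x hx => ?_⟩
  · by_cases hx : x ∈ ball (0 : Euc n) 1
    · exact χ.contDiff.contDiffAt.mul (hu.contDiffAt (isOpen_ball.mem_nhds hx))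
    · have hx' : x ∉ tsupport χ := fun h => hx <| by
        rw [χ.tsupport_eq] at h
        exact closedBall_subset_ball (by change (R + 1) / 2 < 1; linarith) h
      have : (fun x => χ x * u x) =ᶠ[nhds x] fun _ => 0 := by
        filter_upwards [notMem_tsupport_iff_eventuallyEq.1 hx'] with y hy
        simp [hy]
      exact contDiffAt_const.congr_of_eventuallyEq this
  · simp [χ.one_of_mem_closedBall (ball_subset_closedBall hx)]

theorem fderiv_mollification {n : ℕ} {ρ W : Euc n → ℝ} (hρ : Continuous ρ)
    (hW : ContDiff ℝ 1 W) (hWc : HasCompactSupport W) (x : Euc n) :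
    fderiv ℝ (convolution ρ W (ContinuousLinearMap.lsmul ℝ ℝ) volume) x
      = convolution ρ (fderiv ℝ W) (ContinuousLinearMap.lsmul ℝ ℝ) volume x := by
  rw [(hWc.hasFDerivAt_convolution_right (ContinuousLinearMap.lsmul ℝ ℝ) hρ.locallyIntegrable hW
    x).fderiv]
  rfl

theorem fderiv_mollification_apply {n : ℕ} {ρ W : Euc n → ℝ} (hρ : Continuous ρ)
    (hW : ContDiff ℝ 1 W) (hWc : HasCompactSupport W) (x v : Euc n) :
    fderiv ℝ (convolution ρ W (ContinuousLinearMap.lsmul ℝ ℝ) volume) x v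
      = convolution ρ (fun y => fderiv ℝ W y v) (ContinuousLinearMap.lsmul ℝ ℝ) volume x := by
  rw [(hWc.hasFDerivAt_convolution_right (ContinuousLinearMap.lsmul ℝ ℝ) hρ.locallyIntegrable hW
    x).fderiv,
    convolution_precompR_apply _ hρ.locallyIntegrable (hWc.fderiv ℝ)
      (hW.continuous_fderiv one_ne_zero)]

theorem fderiv_fderiv_mollification_apply {n : ℕ} {ρ W : Euc n → ℝ} (hρ : ContDiff ℝ (⊤ : ℕ∞) ρ)
    (hρc : HasCompactSupport ρ) (hW : ContDiff ℝ 1 W) (hWc : HasCompactSupport W)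
    (x v v' : Euc n) :
    fderiv ℝ (fderiv ℝ (convolution ρ W (ContinuousLinearMap.lsmul ℝ ℝ) volume)) x v' v
      = ∫ y, fderiv ℝ W y v * fderiv ℝ ρ (x - y) v' := by
  have hρ1 : ContDiff ℝ 1 ρ := hρ.of_le (by exact_mod_cast le_top)
  have hw : ContDiff ℝ (⊤ : ℕ∞) (convolution ρ W (ContinuousLinearMap.lsmul ℝ ℝ) volume) :=
    hρc.contDiff_convolution_left _ hρ hW.continuous.locallyIntegrable
  have hwd : DifferentiableAt ℝ
      (fderiv ℝ (convolution ρ W (ContinuousLinearMap.lsmul ℝ ℝ) volume)) x :=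
    ((ContDiff.fderiv_right (m := 1) (n := 2) (contDiff_infty.1 hw 2) (by norm_num)).differentiable
      one_ne_zero) x
  have hcW : Continuous fun y => fderiv ℝ W y v :=
    (hW.continuous_fderiv one_ne_zero).clm_apply continuous_const
  have h1 : fderiv ℝ (fderiv ℝ (convolution ρ W (ContinuousLinearMap.lsmul ℝ ℝ) volume)) x v' v
      = fderiv ℝ (fun x => fderiv ℝ (convolution ρ W (ContinuousLinearMap.lsmul ℝ ℝ) volume) x v)
        x v' := by
    rw [fderiv_clm_apply hwd (differentiableAt_const v)]
    simp
  rw [h1]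
  simp_rw [fderiv_mollification_apply hρ.continuous hW hWc]
  have h2 : convolution ρ (fun y => fderiv ℝ W y v) (ContinuousLinearMap.lsmul ℝ ℝ) volume
      = convolution (fun y => fderiv ℝ W y v) ρ (ContinuousLinearMap.lsmul ℝ ℝ).flip volume :=
    (convolution_flip _).symm
  change fderiv ℝ (convolution ρ (fun y => fderiv ℝ W y v) (ContinuousLinearMap.lsmul ℝ ℝ) volume)
    x v' = _
  rw [h2, (hρc.hasFDerivAt_convolution_right (ContinuousLinearMap.lsmul ℝ ℝ).flip
    hcW.locallyIntegrable hρ1 x).fderiv,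
    convolution_precompR_apply _ hcW.locallyIntegrable (hρc.fderiv ℝ)
      (hρ1.continuous_fderiv one_ne_zero), convolution_def]
  refine integral_congr_ae (ae_of_all _ fun y => ?_)
  simp [mul_comm]

/-- Interior approximation of `u` by smooth functions `w`, whose Hessian is controlled by the
mollified weak Hessian of `u`. -/
theorem exists_mollification {n : ℕ} {u : Euc n → ℝ} {H : Euc n → Fin n → Fin n → ℝ}
    (hu : ContDiffOn ℝ 1 u (ball 0 1))
    (hweak : ∀ i j : Fin n, ∀ φ : Euc n → ℝ, ContDiff ℝ (⊤ : ℕ∞) φ → HasCompactSupport φ →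
      tsupport φ ⊆ ball (0 : Euc n) 1 →
      (∫ x in ball (0 : Euc n) 1, gradient u x i * gradient φ x j)
        = - ∫ x in ball (0 : Euc n) 1, H x i j * φ x)
    {r R κ : ℝ} (hr : 0 < r) (hrR : r < R) (hR : R < 1) (hκ : 0 < κ) :
    ∃ w ρ : Euc n → ℝ, ContDiff ℝ 2 w ∧ Continuous ρ ∧ (∀ x, 0 ≤ ρ x) ∧
      ∫⁻ x, ENNReal.ofReal (ρ x) = 1 ∧
      ∀ x ∈ closedBall (0 : Euc n) r, |w x - u x| < κ ∧ ‖fderiv ℝ w x - fderiv ℝ u x‖ < κ ∧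
        (∀ y, ρ (x - y) ≠ 0 → y ∈ closedBall (0 : Euc n) R ∧
          ‖fderiv ℝ w x - fderiv ℝ u y‖ < κ) ∧
        ‖fderiv ℝ (fderiv ℝ w) x‖
          ≤ ∑ j, ∑ i, |∫ y in closedBall (0 : Euc n) R, H y i j * ρ (x - y)| := by
  obtain ⟨W, hW, hWc, hWu⟩ := exists_contDiff_hasCompactSupport_eqOn hu (hr.trans hrR) hR
  have hDWu : ∀ x ∈ ball (0 : Euc n) R, fderiv ℝ W x = fderiv ℝ u x := fun x hx =>
    (hWu.eventuallyEq_of_mem (isOpen_ball.mem_nhds hx)).fderiv_eq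
  have hcDW : Continuous (fderiv ℝ W) := hW.continuous_fderiv one_ne_zero
  obtain ⟨η₁, hη₁, hu₁⟩ := Metric.uniformContinuous_iff.1
    (hWc.uniformContinuous_of_continuous hW.continuous) (κ / 2) (by linarith)
  obtain ⟨η₂, hη₂, hu₂⟩ := Metric.uniformContinuous_iff.1
    ((hWc.fderiv ℝ).uniformContinuous_of_continuous hcDW) (κ / 2) (by linarith)
  obtain ⟨η, hη0, hη⟩ : ∃ η, 0 < η ∧ η < min (min η₁ η₂) (R - r) :=
    exists_between (lt_min (lt_min hη₁ hη₂) (by linarith))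
  obtain ⟨⟨hle₁, hle₂⟩, hle₃⟩ : (η < η₁ ∧ η < η₂) ∧ η < R - r := by
    simpa only [lt_min_iff] using hη
  let b : ContDiffBump (0 : Euc n) := ⟨η / 2, η, by linarith, by linarith⟩
  set ρ : Euc n → ℝ := b.normed volume with hρdef
  have hρ : ContDiff ℝ (⊤ : ℕ∞) ρ := b.contDiff_normed
  have hρc : HasCompactSupport ρ := b.hasCompactSupport_normed
  have hρ0 : ∀ x, 0 ≤ ρ x := b.nonneg_normed
  have hts : tsupport ρ = closedBall 0 η := b.tsupport_normed_eq
  have hclose : ∀ x ∈ closedBall (0 : Euc n) r, ∀ y,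
      x - y ∈ tsupport ρ → y ∈ ball (0 : Euc n) R := by
    intro x hx y hy
    rw [hts, mem_closedBall_zero_iff] at hy
    rw [mem_closedBall_zero_iff] at hx
    rw [mem_ball_zero_iff]
    have := norm_sub_norm_le y x
    rw [norm_sub_rev] at this
    linarith
  set w : Euc n → ℝ := convolution ρ W (ContinuousLinearMap.lsmul ℝ ℝ) volume with hwdef
  have hw : ContDiff ℝ (⊤ : ℕ∞) w :=
    hρc.contDiff_convolution_left _ hρ hW.continuous.locallyIntegrable
  refine ⟨w, ρ, contDiff_infty.1 hw 2, hρ.continuous, hρ0, ?_, fun x hx => ?_⟩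
  · rw [← ofReal_integral_eq_lintegral_ofReal b.integrable_normed (ae_of_all _ hρ0),
      b.integral_normed, ENNReal.ofReal_one]
  have hxR : x ∈ ball (0 : Euc n) R := closedBall_subset_ball hrR hx
  have hDw : dist (fderiv ℝ w x) (fderiv ℝ W x) ≤ κ / 2 := by
    rw [hwdef, fderiv_mollification hρ.continuous hW hWc]
    exact b.dist_normed_convolution_le hcDW.aestronglyMeasurable fun y hy =>
      (hu₂ ((mem_ball.1 hy).trans hle₂)).le
  refine ⟨?_, ?_, fun y hy => ?_, ?_⟩
  · rw [← hWu hxR, ← Real.dist_eq]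
    refine lt_of_le_of_lt ?_ (half_lt_self hκ)
    exact b.dist_normed_convolution_le hW.continuous.aestronglyMeasurable fun y hy =>
      (hu₁ ((mem_ball.1 hy).trans hle₁)).le
  · rw [← hDWu x hxR, ← dist_eq_norm]
    linarith
  · have hyR := hclose x hx y (subset_tsupport _ hy)
    refine ⟨ball_subset_closedBall hyR, ?_⟩
    have hxy : x - y ∈ closedBall (0 : Euc n) η := hts ▸ subset_tsupport _ hy
    have h1 : dist (fderiv ℝ W x) (fderiv ℝ W y) < κ / 2 := by
      refine hu₂ (lt_of_le_of_lt ?_ hle₂)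
      rw [dist_eq_norm]; exact mem_closedBall_zero_iff.1 hxy
    rw [← hDWu y hyR, ← dist_eq_norm]
    linarith [dist_triangle (fderiv ℝ w x) (fderiv ℝ W x) (fderiv ℝ W y)]
  · have hentry : ∀ i j : Fin n, fderiv ℝ (fderiv ℝ w) x (EuclideanSpace.single j 1)
        (EuclideanSpace.single i 1) = ∫ y in closedBall (0 : Euc n) R, H y i j * ρ (x - y) := by
      intro i j
      have hφ : ContDiff ℝ (⊤ : ℕ∞) fun y => ρ (x - y) := hρ.comp (contDiff_const.sub contDiff_id)
      have hφs : tsupport (fun y => ρ (x - y)) ⊆ closedBall (0 : Euc n) R :=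
        (closure_minimal (t := {y | x - y ∈ tsupport ρ})
          (fun y hy => subset_tsupport _ hy)
          ((isClosed_tsupport ρ).preimage (by fun_prop : Continuous fun y => x - y))).trans
          fun y hy => ball_subset_closedBall (hclose x hx y hy)
      have hφc : HasCompactSupport fun y => ρ (x - y) :=
        (isCompact_closedBall (0 : Euc n) R).of_isClosed_subset (isClosed_tsupport _) hφs
      have hφD : ∀ y, gradient (fun y => ρ (x - y)) y j
          = -fderiv ℝ ρ (x - y) (EuclideanSpace.single j 1) := by
        intro y
        have h : HasFDerivAt (fun y => ρ (x - y)) _ y :=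
          (hρ.differentiable (by simp) (x - y)).hasFDerivAt.comp y ((hasFDerivAt_id y).const_sub x)
        rw [gradient_apply_eq_fderiv_single, h.fderiv]
        simp
      have key := hweak i j _ hφ hφc (hφs.trans (closedBall_subset_ball hR))
      rw [fderiv_fderiv_mollification_apply hρ hρc hW hWc]
      have e1 : ∫ y in ball (0 : Euc n) 1, gradient u y i * gradient (fun y => ρ (x - y)) y j
          = - ∫ y, fderiv ℝ W y (EuclideanSpace.single i 1)
            * fderiv ℝ ρ (x - y) (EuclideanSpace.single j 1) := by
        rw [← integral_neg]
        refine Eq.trans ?_ (setIntegral_eq_integral_of_forall_compl_eq_zero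
          (s := ball (0 : Euc n) 1) ?_)
        · refine integral_congr_ae (ae_of_all _ fun y => ?_)
          simp only [hφD]
          by_cases hy : x - y ∈ tsupport ρ
          · rw [hDWu y (hclose x hx y hy), gradient_apply_eq_fderiv_single]; ring
          · have : fderiv ℝ ρ (x - y) = 0 := fderiv_of_notMem_tsupport ℝ hy
            simp [this]
        · intro y hy
          have hy' : x - y ∉ tsupport ρ := fun h =>
            hy (ball_subset_ball hR.le (hclose x hx y h))
          have : fderiv ℝ ρ (x - y) = 0 := fderiv_of_notMem_tsupport ℝ hy'
          simp [this]
      have e2 : ∫ y in ball (0 : Euc n) 1, H y i j * ρ (x - y)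
          = ∫ y in closedBall (0 : Euc n) R, H y i j * ρ (x - y) := by
        refine setIntegral_eq_of_subset_of_forall_sdiff_eq_zero measurableSet_ball
          (closedBall_subset_ball hR) fun y hy => ?_
        have : ρ (x - y) = 0 := by
          by_contra h
          exact hy.2 (ball_subset_closedBall (hclose x hx y (subset_tsupport _ h)))
        simp [this]
      rw [e1, e2] at key
      exact neg_injective key
    refine (norm_le_sum_norm_apply_single _).trans (Finset.sum_le_sum fun j _ => ?_)
    refine (norm_le_sum_norm_apply_single _).trans (Finset.sum_le_sum fun i _ => ?_)
    rw [hentry, Real.norm_eq_abs]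

theorem exists_abs_rpow_sub_rpow_lt {a δ : ℝ} (ha : 0 ≤ a) (hδ : 0 < δ) (M : ℝ) :
    ∃ κ > 0, ∀ s ∈ Icc 0 M, ∀ t ∈ Icc 0 M, |s - t| < κ → |s ^ a - t ^ a| < δ := by
  have h := isCompact_Icc.uniformContinuousOn_of_continuous
    (f := fun s : ℝ => s ^ a) (s := Icc 0 M) (Real.continuous_rpow_const ha).continuousOn
  obtain ⟨κ, hκ, hκ'⟩ := Metric.uniformContinuousOn_iff.1 h δ hδ
  exact ⟨κ, hκ, fun s hs t ht hst => by simpa [Real.dist_eq] using hκ' s hs t ht hst⟩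

theorem le_of_forall_pos_le_add_mul {X Y Z : ℝ} (hZ : 0 ≤ Z)
    (h : ∀ δ > 0, X ≤ Y + δ * Z) : X ≤ Y := by
  refine le_of_forall_pos_le_add fun ε hε => (h (ε / (Z + 1)) (by positivity)).trans ?_
  have : ε / (Z + 1) * Z ≤ ε := by
    rw [div_mul_eq_mul_div, div_le_iff₀ (by positivity)]
    nlinarith
  linarith

/-- The Frobenius norm of a square array of real numbers. -/
def frobNorm {n : ℕ} (B : Fin n → Fin n → ℝ) : ℝ := Real.sqrt (∑ i, ∑ j, B i j ^ 2)

theorem frobNorm_nonneg {n : ℕ} (B : Fin n → Fin n → ℝ) : 0 ≤ frobNorm B := Real.sqrt_nonneg _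

theorem continuous_frobNorm {n : ℕ} : Continuous (frobNorm (n := n)) := by
  unfold frobNorm
  fun_prop

theorem abs_le_frobNorm {n : ℕ} (B : Fin n → Fin n → ℝ) (i j : Fin n) :
    |B i j| ≤ frobNorm B := by
  refine Real.abs_le_sqrt ?_
  refine (Finset.single_le_sum (f := fun j => B i j ^ 2) (fun j _ => sq_nonneg _)
    (Finset.mem_univ j)).trans ?_
  exact Finset.single_le_sum (f := fun i => ∑ j, B i j ^ 2)
    (fun i _ => Finset.sum_nonneg fun j _ => sq_nonneg _) (Finset.mem_univ i)

theorem frobNorm_le {n : ℕ} (B : Fin n → Fin n → ℝ) : frobNorm B ≤ n * ‖B‖ := by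
  refine Real.sqrt_le_iff.2 ⟨by positivity, ?_⟩
  have : ∀ i j, B i j ^ 2 ≤ ‖B‖ ^ 2 := fun i j => by
    rw [← sq_abs]
    gcongr
    exact (norm_le_pi_norm (B i) j).trans (norm_le_pi_norm B i)
  calc ∑ i, ∑ j, B i j ^ 2 ≤ ∑ _i : Fin n, ∑ _j : Fin n, ‖B‖ ^ 2 :=
        Finset.sum_le_sum fun i _ => Finset.sum_le_sum fun j _ => this i j
    _ = (n * ‖B‖) ^ 2 := by simp; ring

theorem integrableOn_frobNorm {n : ℕ} {H : Euc n → Fin n → Fin n → ℝ} {s : Set (Euc n)}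
    (hH : IntegrableOn H s) : IntegrableOn (fun x => frobNorm (H x)) s := by
  refine (hH.norm.const_mul (n : ℝ)).mono'
    (continuous_frobNorm.comp_aestronglyMeasurable hH.aestronglyMeasurable)
    (ae_of_all _ fun x => ?_)
  rw [Real.norm_of_nonneg (frobNorm_nonneg _)]
  exact frobNorm_le _

/-- Tonelli's theorem for a weighted mollification of `G`. -/
theorem lintegral_lintegral_mollification_le {n : ℕ} {S T : Set (Euc n)} {a ρ G P : Euc n → ℝ}
    (hS : MeasurableSet S) (ha : Continuous a) (hρ : Continuous ρ) (hρ0 : ∀ x, 0 ≤ ρ x)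
    (hρ1 : ∫⁻ x, ENNReal.ofReal (ρ x) = 1) (hG : AEStronglyMeasurable G (volume.restrict T))
    (hG0 : ∀ x, 0 ≤ G x) (haP : ∀ x ∈ S, ∀ y, ρ (x - y) ≠ 0 → a x ≤ P y) :
    ∫⁻ x in S, ∫⁻ y in T, ENNReal.ofReal (a x * (G y * ρ (x - y)))
      ≤ ∫⁻ y in T, ENNReal.ofReal (P y * G y) := by
  rw [lintegral_lintegral_swap]
  · refine lintegral_mono fun y => ?_
    calc ∫⁻ x in S, ENNReal.ofReal (a x * (G y * ρ (x - y)))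
        ≤ ∫⁻ x in S, ENNReal.ofReal (P y * G y) * ENNReal.ofReal (ρ (x - y)) := by
          refine setLIntegral_mono' hS fun x hx => ?_
          rw [← ENNReal.ofReal_mul' (hρ0 _)]
          refine ENNReal.ofReal_le_ofReal ?_
          by_cases h : ρ (x - y) = 0
          · simp [h]
          · rw [← mul_assoc]
            gcongr
            · exact hρ0 _
            · exact hG0 _
            · exact haP x hx y h
      _ ≤ ∫⁻ x, ENNReal.ofReal (P y * G y) * ENNReal.ofReal (ρ (x - y)) :=
          setLIntegral_le_lintegral _ _
      _ = ENNReal.ofReal (P y * G y) := by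
          rw [lintegral_const_mul' _ _ ENNReal.ofReal_ne_top,
            lintegral_sub_right_eq_self (fun x => ENNReal.ofReal (ρ x)) y, hρ1, mul_one]
  · refine AEMeasurable.ennreal_ofReal ?_
    refine ((ha.comp continuous_fst).aemeasurable).mul (AEMeasurable.mul ?_ ?_)
    · exact hG.aemeasurable.comp_snd
    · exact (hρ.comp (continuous_fst.sub continuous_snd)).aemeasurable

/-- If `b` is dominated by the mollified entries of `H` and `a` by `P` on the support of the
mollifier, then `∫ a b` is controlled by `∫ P |H|`. -/
theorem setIntegral_mul_hessian_le {n : ℕ} {r R : ℝ} {a b ρ P : Euc n → ℝ}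
    {H : Euc n → Fin n → Fin n → ℝ} (ha : Continuous a) (ha0 : ∀ x, 0 ≤ a x)
    (hb : Continuous b) (hb0 : ∀ x, 0 ≤ b x)
    (hρ : Continuous ρ) (hρ0 : ∀ x, 0 ≤ ρ x) (hρ1 : ∫⁻ x, ENNReal.ofReal (ρ x) = 1)
    (hH : IntegrableOn H (closedBall (0 : Euc n) R)) (hP0 : ∀ x, 0 ≤ P x)
    (hPH : IntegrableOn (fun x => P x * frobNorm (H x)) (closedBall (0 : Euc n) R))
    (haP : ∀ x ∈ closedBall (0 : Euc n) r, ∀ y, ρ (x - y) ≠ 0 → a x ≤ P y)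
    (hbH : ∀ x ∈ closedBall (0 : Euc n) r,
      b x ≤ ∑ j, ∑ i, |∫ y in closedBall (0 : Euc n) R, H y i j * ρ (x - y)|) :
    ∫ x in closedBall (0 : Euc n) r, a x * b x
      ≤ (n : ℝ) ^ 2 * ∫ x in closedBall (0 : Euc n) R, P x * frobNorm (H x) := by
  have hG := integrableOn_frobNorm hH
  have hbH' : ∀ x ∈ closedBall (0 : Euc n) r, ENNReal.ofReal (b x)
      ≤ ENNReal.ofReal ((n : ℝ) ^ 2)
        * ∫⁻ y in closedBall (0 : Euc n) R, ENNReal.ofReal (frobNorm (H y) * ρ (x - y)) := by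
    intro x hx
    have hterm : ∀ i j, ENNReal.ofReal |∫ y in closedBall (0 : Euc n) R, H y i j * ρ (x - y)|
        ≤ ∫⁻ y in closedBall (0 : Euc n) R, ENNReal.ofReal (frobNorm (H y) * ρ (x - y)) := by
      intro i j
      rw [← Real.enorm_eq_ofReal_abs]
      refine (enorm_integral_le_lintegral_enorm _).trans (lintegral_mono fun y => ?_)
      rw [Real.enorm_eq_ofReal_abs, abs_mul, abs_of_nonneg (hρ0 _)]
      refine ENNReal.ofReal_le_ofReal ?_
      gcongr
      · exact hρ0 _
      · exact abs_le_frobNorm _ _ _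
    refine (ENNReal.ofReal_le_ofReal (hbH x hx)).trans ?_
    rw [ENNReal.ofReal_sum_of_nonneg fun j _ => Finset.sum_nonneg fun i _ => abs_nonneg _]
    simp_rw [ENNReal.ofReal_sum_of_nonneg fun i _ => abs_nonneg _]
    refine (Finset.sum_le_sum fun j _ => Finset.sum_le_sum fun i _ => hterm i j).trans_eq ?_
    simp [sq, mul_assoc]
  have hint : IntegrableOn (fun x => a x * b x) (closedBall (0 : Euc n) r) :=
    (ha.mul hb).continuousOn.integrableOn_compact (isCompact_closedBall _ _)
  have hPH0 : 0 ≤ ∫ x in closedBall (0 : Euc n) R, P x * frobNorm (H x) :=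
    integral_nonneg fun x => mul_nonneg (hP0 x) (frobNorm_nonneg _)
  rw [← ENNReal.ofReal_le_ofReal_iff (by positivity),
    ofReal_integral_eq_lintegral_ofReal hint (ae_of_all _ fun x => mul_nonneg (ha0 x) (hb0 x)),
    ENNReal.ofReal_mul (by positivity), ofReal_integral_eq_lintegral_ofReal hPH
      (ae_of_all _ fun x => mul_nonneg (hP0 x) (frobNorm_nonneg _))]
  calc ∫⁻ x in closedBall (0 : Euc n) r, ENNReal.ofReal (a x * b x)
      ≤ ∫⁻ x in closedBall (0 : Euc n) r, ENNReal.ofReal ((n : ℝ) ^ 2) *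
        ∫⁻ y in closedBall (0 : Euc n) R,
          ENNReal.ofReal (a x * (frobNorm (H y) * ρ (x - y))) := by
        refine setLIntegral_mono' measurableSet_closedBall fun x hx => ?_
        simp_rw [ENNReal.ofReal_mul (ha0 x)]
        rw [lintegral_const_mul' _ _ ENNReal.ofReal_ne_top]
        refine (mul_le_mul_right (hbH' x hx) _).trans_eq ?_
        ring
    _ ≤ _ := by
        rw [lintegral_const_mul' _ _ ENNReal.ofReal_ne_top]
        refine mul_le_mul_right ?_ _
        exact lintegral_lintegral_mollification_le measurableSet_closedBall ha hρ hρ0 hρ1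
          hG.aestronglyMeasurable (fun x => frobNorm_nonneg _) haP

/-- Transfer of an interpolation inequality on a smaller ball from `C²` functions to `C¹` functions
with a weak Hessian. -/
theorem setIntegral_norm_fderiv_rpow_le_of_lt_one {n : ℕ} {q A r h : ℝ} (hq : 1 ≤ q) (hA : 0 ≤ A)
    (hr : 0 < r) (hr1 : r < 1) (hh : 0 < h) {u : Euc n → ℝ} {H : Euc n → Fin n → Fin n → ℝ}
    (hAr : ∀ w : Euc n → ℝ, ContDiff ℝ 2 w →
      ∫ x in closedBall (0 : Euc n) r, ‖fderiv ℝ w x‖ ^ q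
        ≤ A * (h * ∫ x in closedBall (0 : Euc n) r,
            ‖fderiv ℝ w x‖ ^ (q - 1) * ‖fderiv ℝ (fderiv ℝ w) x‖)
          + A * (h ^ (-q) * ∫ x in closedBall (0 : Euc n) r, |w x| ^ q))
    (hu : ContDiffOn ℝ 1 u (ball 0 1))
    (huq : IntegrableOn (fun x => |u x| ^ q) (ball (0 : Euc n) 1))
    (hH : LocallyIntegrableOn H (ball (0 : Euc n) 1))
    (hweak : ∀ i j : Fin n, ∀ φ : Euc n → ℝ, ContDiff ℝ (⊤ : ℕ∞) φ → HasCompactSupport φ →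
      tsupport φ ⊆ ball (0 : Euc n) 1 →
      (∫ x in ball (0 : Euc n) 1, gradient u x i * gradient φ x j)
        = - ∫ x in ball (0 : Euc n) 1, H x i j * φ x)
    (huH : IntegrableOn (fun x => ‖fderiv ℝ u x‖ ^ (q - 1) * frobNorm (H x))
      (ball (0 : Euc n) 1)) :
    ∫ x in closedBall (0 : Euc n) r, ‖fderiv ℝ u x‖ ^ q
      ≤ A * (h * ((n : ℝ) ^ 2 * ∫ x in ball (0 : Euc n) 1,
          ‖fderiv ℝ u x‖ ^ (q - 1) * frobNorm (H x)))
        + A * (h ^ (-q) * ∫ x in ball (0 : Euc n) 1, |u x| ^ q) := by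
  obtain ⟨R, hrR, hR1⟩ := exists_between hr1
  have hR0 : 0 < R := hr.trans hrR
  have hsubR : closedBall (0 : Euc n) R ⊆ ball 0 1 := closedBall_subset_ball hR1
  have hsubr : closedBall (0 : Euc n) r ⊆ closedBall 0 R := closedBall_subset_closedBall hrR.le
  have hHR : IntegrableOn H (closedBall (0 : Euc n) R) :=
    hH.integrableOn_compact_subset hsubR (isCompact_closedBall _ _)
  have hG := integrableOn_frobNorm hHR
  have hDu : ContinuousOn (fun x => ‖fderiv ℝ u x‖) (ball 0 1) :=
    (hu.continuousOn_fderiv_of_isOpen isOpen_ball le_rfl).norm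
  have hua : ContinuousOn (fun x => |u x|) (ball 0 1) := hu.continuousOn.abs
  obtain ⟨M₁, hM₁⟩ := (isCompact_closedBall (0 : Euc n) R).bddAbove_image (hDu.mono hsubR)
  obtain ⟨M₂, hM₂⟩ := (isCompact_closedBall (0 : Euc n) R).bddAbove_image (hua.mono hsubR)
  set M := max M₁ M₂ + 1
  have hMD : ∀ x ∈ closedBall (0 : Euc n) R, ‖fderiv ℝ u x‖ + 1 ≤ M := fun x hx => by
    have := hM₁ (mem_image_of_mem _ hx)
    have := le_max_left M₁ M₂
    simp only [M]; linarith
  have hMu : ∀ x ∈ closedBall (0 : Euc n) R, |u x| + 1 ≤ M := fun x hx => by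
    have := hM₂ (mem_image_of_mem _ hx)
    have := le_max_right M₁ M₂
    simp only [M]; linarith
  set V := volume.real (closedBall (0 : Euc n) r)
  set K := ∫ x in closedBall (0 : Euc n) R, frobNorm (H x)
  have hK : 0 ≤ K := integral_nonneg fun x => frobNorm_nonneg _
  have hZ : 0 ≤ V + A * (h * ((n : ℝ) ^ 2 * K)) + A * (h ^ (-q) * V) := by positivity
  refine le_of_forall_pos_le_add_mul hZ fun δ hδ => ?_
  obtain ⟨κ₁, hκ₁, hq₁⟩ := exists_abs_rpow_sub_rpow_lt (a := q) (by linarith) hδ M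
  obtain ⟨κ₂, hκ₂, hq₂⟩ := exists_abs_rpow_sub_rpow_lt (a := q - 1) (by linarith) hδ M
  obtain ⟨w, ρ, hw, hρ, hρ0, hρ1, hwρ⟩ := exists_mollification hu hweak hr hrR hR1
    (lt_min one_pos (lt_min hκ₁ hκ₂))
  have hcD : Continuous (fderiv ℝ w) := hw.continuous_fderiv (by norm_num)
  have hcDD : Continuous (fderiv ℝ (fderiv ℝ w)) :=
    (hw.fderiv_right (m := 1) (by norm_num)).continuous_fderiv (by norm_num)
  have hcq : Continuous fun x => ‖fderiv ℝ w x‖ ^ q :=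
    hcD.norm.rpow_const fun _ => Or.inr (by linarith)
  have hca : Continuous fun x => ‖fderiv ℝ w x‖ ^ (q - 1) :=
    hcD.norm.rpow_const fun _ => Or.inr (by linarith)
  have hcw : Continuous fun x => |w x| ^ q :=
    hw.continuous.abs.rpow_const fun _ => Or.inr (by linarith)
  have huHR := huH.mono_set hsubR
  have hPH : IntegrableOn (fun x => (‖fderiv ℝ u x‖ ^ (q - 1) + δ) * frobNorm (H x))
      (closedBall (0 : Euc n) R) := by
    simp_rw [add_mul]
    exact huHR.add (hG.const_mul δ)
  have hD : ∫ x in closedBall (0 : Euc n) r, ‖fderiv ℝ u x‖ ^ q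
      ≤ (∫ x in closedBall (0 : Euc n) r, ‖fderiv ℝ w x‖ ^ q) + δ * V := by
    have hle : ∫ x in closedBall (0 : Euc n) r, ‖fderiv ℝ u x‖ ^ q
        ≤ ∫ x in closedBall (0 : Euc n) r, (‖fderiv ℝ w x‖ ^ q + δ) := by
      refine setIntegral_mono_on ?_ ?_ measurableSet_closedBall fun x hx => ?_
      · exact (((hDu.mono (hsubr.trans hsubR)).rpow_const fun _ _ =>
          Or.inr (by linarith))).integrableOn_compact (isCompact_closedBall _ _)
      · exact (hcq.add continuous_const).continuousOn.integrableOn_compact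
          (isCompact_closedBall _ _)
      · have h1 := lt_min_iff.1 (hwρ x hx).2.1
        have h2 := lt_min_iff.1 h1.2
        have h3 := hMD x (hsubr hx)
        have h4 := abs_le.1 (abs_norm_sub_norm_le (fderiv ℝ w x) (fderiv ℝ u x))
        have h5 := abs_lt.1 (hq₁ ‖fderiv ℝ w x‖ ⟨norm_nonneg _, by linarith⟩
          ‖fderiv ℝ u x‖ ⟨norm_nonneg _, by linarith⟩
          ((abs_norm_sub_norm_le _ _).trans_lt h2.1))
        linarith
    rwa [integral_add (hcq.continuousOn.integrableOn_compact (isCompact_closedBall _ _))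
      (integrableOn_const measure_closedBall_lt_top.ne), setIntegral_const, smul_eq_mul,
      mul_comm V] at hle
  have hW : ∫ x in closedBall (0 : Euc n) r, |w x| ^ q
      ≤ (∫ x in ball (0 : Euc n) 1, |u x| ^ q) + δ * V := by
    have hle : ∫ x in closedBall (0 : Euc n) r, |w x| ^ q
        ≤ ∫ x in closedBall (0 : Euc n) r, (|u x| ^ q + δ) := by
      refine setIntegral_mono_on ?_ ?_ measurableSet_closedBall fun x hx => ?_
      · exact hcw.continuousOn.integrableOn_compact (isCompact_closedBall _ _)
      · exact (huq.mono_set (hsubr.trans hsubR)).add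
          (integrableOn_const measure_closedBall_lt_top.ne)
      · have h1 := lt_min_iff.1 (hwρ x hx).1
        have h2 := lt_min_iff.1 h1.2
        have h3 := hMu x (hsubr hx)
        have h4 := abs_le.1 (abs_abs_sub_abs_le_abs_sub (w x) (u x))
        have h5 := abs_lt.1 (hq₁ |w x| ⟨abs_nonneg _, by linarith⟩
          |u x| ⟨abs_nonneg _, by linarith⟩
          ((abs_abs_sub_abs_le_abs_sub _ _).trans_lt h2.1))
        linarith
    rw [integral_add (huq.mono_set (hsubr.trans hsubR))
      (integrableOn_const measure_closedBall_lt_top.ne), setIntegral_const, smul_eq_mul,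
      mul_comm V] at hle
    have := setIntegral_mono_set huq
      (ae_of_all _ fun x => by positivity) (LE.le.eventuallyLE (hsubr.trans hsubR))
    linarith
  have hHess : ∫ x in closedBall (0 : Euc n) r,
      ‖fderiv ℝ w x‖ ^ (q - 1) * ‖fderiv ℝ (fderiv ℝ w) x‖
      ≤ (n : ℝ) ^ 2 * ((∫ x in ball (0 : Euc n) 1,
          ‖fderiv ℝ u x‖ ^ (q - 1) * frobNorm (H x)) + δ * K) := by
    refine (setIntegral_mul_hessian_le (P := fun y => ‖fderiv ℝ u y‖ ^ (q - 1) + δ) hca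
      (fun x => by positivity)
      (Continuous.norm (E := Euc n →L[ℝ] Euc n →L[ℝ] ℝ) hcDD) (fun x => norm_nonneg _) hρ hρ0 hρ1
      hHR (fun x => by positivity) hPH (fun x hx y hy => ?_)
      (fun x hx => (hwρ x hx).2.2.2)).trans ?_
    · obtain ⟨hy', hlt⟩ := (hwρ x hx).2.2.1 y hy
      have h1 := lt_min_iff.1 hlt
      have h2 := lt_min_iff.1 h1.2
      have h3 := hMD y hy'
      have h4 := abs_le.1 (abs_norm_sub_norm_le (fderiv ℝ w x) (fderiv ℝ u y))
      have h5 := abs_lt.1 (hq₂ ‖fderiv ℝ w x‖ ⟨norm_nonneg _, by linarith⟩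
        ‖fderiv ℝ u y‖ ⟨norm_nonneg _, by linarith⟩
        ((abs_norm_sub_norm_le _ _).trans_lt h2.2))
      linarith
    · simp_rw [add_mul]
      rw [integral_add huHR (hG.const_mul δ), integral_const_mul]
      have := setIntegral_mono_set huH
        (ae_of_all _ fun x => mul_nonneg (by positivity) (frobNorm_nonneg _))
        (LE.le.eventuallyLE hsubR)
      gcongr
  calc _ ≤ _ := hD
    _ ≤ A * (h * ((n : ℝ) ^ 2 * ((∫ x in ball (0 : Euc n) 1,
          ‖fderiv ℝ u x‖ ^ (q - 1) * frobNorm (H x)) + δ * K)))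
        + A * (h ^ (-q) * ((∫ x in ball (0 : Euc n) 1, |u x| ^ q) + δ * V)) + δ * V := by
      gcongr
      refine (hAr w hw).trans ?_
      gcongr
    _ = _ := by ring

theorem setIntegral_ball_le_of_forall_closedBall_le {n : ℕ} {f : Euc n → ℝ} {Y : ℝ}
    (hf : IntegrableOn f (ball 0 1))
    (h : ∀ r ∈ Ico (1 / 4 : ℝ) 1, ∫ x in closedBall (0 : Euc n) r, f x ≤ Y) :
    ∫ x in ball (0 : Euc n) 1, f x ≤ Y := by
  have hr : ∀ k : ℕ, 1 - 1 / ((k : ℝ) + 2) ∈ Ico (1 / 4 : ℝ) 1 := fun k => by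
    have h1 : 1 / ((k : ℝ) + 2) ≤ 1 / 2 := by gcongr; linarith [k.cast_nonneg (α := ℝ)]
    have h2 : 0 < 1 / ((k : ℝ) + 2) := by positivity
    constructor <;> linarith
  have hU : ⋃ k : ℕ, closedBall (0 : Euc n) (1 - 1 / ((k : ℝ) + 2)) = ball 0 1 := by
    refine Subset.antisymm (iUnion_subset fun k => closedBall_subset_ball (hr k).2) fun x hx => ?_
    rw [mem_ball] at hx
    obtain ⟨k, hk⟩ := exists_nat_one_div_lt (sub_pos.2 hx)
    refine mem_iUnion.2 ⟨k, mem_closedBall.2 ?_⟩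
    have : 1 / ((k : ℝ) + 2) ≤ 1 / ((k : ℝ) + 1) := by gcongr; norm_num
    linarith
  have hmono : Monotone fun k : ℕ => closedBall (0 : Euc n) (1 - 1 / ((k : ℝ) + 2)) :=
    fun k l hkl => closedBall_subset_closedBall (by gcongr)
  have ht := tendsto_setIntegral_of_monotone (μ := volume) (f := f)
    (fun k : ℕ => measurableSet_closedBall (x := (0 : Euc n)) (ε := 1 - 1 / ((k : ℝ) + 2)))
    hmono (by rwa [hU])
  rw [hU] at ht
  exact le_of_tendsto' ht fun k => h _ (hr k)

/-- Proposition 5.2: an interpolation inequality adapted to the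
`p`-Laplacian. Let `p ≥ 2`, `ε ∈ (0,1)`, and `u ∈ C¹(B₁) ∩ W^{1,p−1}(B₁)` be such that
`∇u` has a distributional Jacobian represented by a locally integrable matrix-valued
function `H = D²u` with `∫_{B₁} |∇u|^{p−2} |D²u| < ∞` (here `|D²u|` is the Frobenius
norm). Then
`∫_{B₁} |∇u|^{p−1} ≤ ε ∫_{B₁} |∇u|^{p−2}|D²u| + C ε^{1−p} ∫_{B₁} |u|^{p−1}`,
where `C` depends only on `n` and `p`. -/
theorem statement19 (n : ℕ) (p : ℝ) (hp : 2 ≤ p) :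
    ∃ C : ℝ, 0 < C ∧
      ∀ ε ∈ Ioo (0 : ℝ) 1,
        ∀ (u : Euc n → ℝ) (H : Euc n → Fin n → Fin n → ℝ),
          ContDiffOn ℝ 1 u (ball 0 1) →
          IntegrableOn (fun x => |u x| ^ (p - 1)) (ball (0 : Euc n) 1) →
          IntegrableOn (fun x => ‖gradient u x‖ ^ (p - 1)) (ball (0 : Euc n) 1) →
          LocallyIntegrableOn H (ball (0 : Euc n) 1) →
          (∀ i j : Fin n, ∀ φ : Euc n → ℝ, ContDiff ℝ (⊤ : ℕ∞) φ → HasCompactSupport φ →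
            tsupport φ ⊆ ball (0 : Euc n) 1 →
            (∫ x in ball (0 : Euc n) 1, gradient u x i * gradient φ x j)
              = - ∫ x in ball (0 : Euc n) 1, H x i j * φ x) →
          IntegrableOn (fun x => ‖gradient u x‖ ^ (p - 2) *
            Real.sqrt (∑ i : Fin n, ∑ j : Fin n, H x i j ^ 2)) (ball (0 : Euc n) 1) →
          (∫ x in ball (0 : Euc n) 1, ‖gradient u x‖ ^ (p - 1))
            ≤ ε * (∫ x in ball (0 : Euc n) 1, ‖gradient u x‖ ^ (p - 2) *
                  Real.sqrt (∑ i : Fin n, ∑ j : Fin n, H x i j ^ 2))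
              + C * ε ^ (1 - p) * ∫ x in ball (0 : Euc n) 1, |u x| ^ (p - 1) := by
  obtain ⟨A, hA1, hA⟩ := exists_setIntegral_norm_fderiv_rpow_le n (q := p - 1) (by linarith)
  set B := A * ((n : ℝ) ^ 2 + 1) with hB
  have hB1 : 1 ≤ B := by nlinarith [sq_nonneg (n : ℝ)]
  have hC : 0 < A * (2 * B) ^ (p - 1) := by positivity
  refine ⟨A * (2 * B) ^ (p - 1), hC, fun ε hε u H hu huq hDu hH hweak huH => ?_⟩
  simp_rw [norm_gradient_eq_norm_fderiv] at hDu huH ⊢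
  have hε0 : 0 < ε := hε.1
  have hp2 : p - 2 = p - 1 - 1 := by ring
  have hp1 : 1 - p = -(p - 1) := by ring
  rw [hp2] at huH ⊢
  rw [hp1]
  refine setIntegral_ball_le_of_forall_closedBall_le hDu fun r hr => ?_
  have hh0 : 0 < ε / (2 * B) := by positivity
  have hh : ε / (2 * B) ≤ 1 / 2 := by
    rw [div_le_div_iff₀ (by positivity) two_pos]
    linarith [hε.2]
  refine (setIntegral_norm_fderiv_rpow_le_of_lt_one (by linarith) (by linarith)
    (by linarith [hr.1]) hr.2 hh0 (hA r ⟨hr.1, hr.2.le⟩ _ ⟨hh0, hh⟩) hu huq hH hweak huH).trans ?_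
  have hI : 0 ≤ ∫ x in ball (0 : Euc n) 1,
      ‖fderiv ℝ u x‖ ^ (p - 1 - 1) * frobNorm (H x) :=
    integral_nonneg fun x => mul_nonneg (by positivity) (frobNorm_nonneg _)
  refine add_le_add ?_ (le_of_eq ?_)
  · calc A * (ε / (2 * B) * ((n : ℝ) ^ 2 * ∫ x in ball (0 : Euc n) 1,
          ‖fderiv ℝ u x‖ ^ (p - 1 - 1) * frobNorm (H x)))
        = A * (n : ℝ) ^ 2 / (2 * B) * (ε * ∫ x in ball (0 : Euc n) 1,
          ‖fderiv ℝ u x‖ ^ (p - 1 - 1) * frobNorm (H x)) := by ring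
      _ ≤ 1 * (ε * ∫ x in ball (0 : Euc n) 1,
          ‖fderiv ℝ u x‖ ^ (p - 1 - 1) * frobNorm (H x)) := by
        gcongr
        rw [div_le_one (by positivity)]
        nlinarith [sq_nonneg (n : ℝ)]
      _ = _ := one_mul _
  · rw [Real.div_rpow hε0.le (by positivity), Real.rpow_neg (x := 2 * B) (by positivity),
      div_inv_eq_mul]
    ring
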